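/- arXiv:2203.09410 — 4 statements merged into one kernel-verified Lean document; each statement's English description precedes it below -/
import Mathlib

section
/- Let v ∈ ℝ^p and let c ∈ ℝ satisfy c · ⟨v, v⟩ ≥ −1. Then I + c v vᵀ = (I + (c / (1 + √(1 + c ⟨v, v⟩))) v vᵀ)², where I is the p × p identity matrix and v vᵀ denotes the outer product of v with itself. -/
open Matrix

/-- Lemma: square-root formula for a rank-one update of the identity.
If `c * ⟨v, v⟩ ≥ -1`, then `I + c v vᵀ = (I + (c / (1 + √(1 + c ⟨v, v⟩))) v vᵀ)²`. -/
theorem stmt_1 (p : ℕ) (v : Fin p → ℝ) (c : ℝ) (hc : c * (v ⬝ᵥ v) ≥ -1) :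
    (1 : Matrix (Fin p) (Fin p) ℝ) + c • vecMulVec v v =
      ((1 : Matrix (Fin p) (Fin p) ℝ) +
        (c / (1 + Real.sqrt (1 + c * (v ⬝ᵥ v)))) • vecMulVec v v) ^ 2 := by
  have hs : Real.sqrt (1 + c * (v ⬝ᵥ v)) ^ 2 = 1 + c * (v ⬝ᵥ v) :=
    Real.sq_sqrt (by linarith)
  have hs0 := Real.sqrt_nonneg (1 + c * (v ⬝ᵥ v))
  set s := Real.sqrt (1 + c * (v ⬝ᵥ v))
  have hsq : vecMulVec v v * vecMulVec v v = (v ⬝ᵥ v) • vecMulVec v v := by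
    rw [vecMulVec_mul_vecMulVec, vecMulVec_smul]
  have hcoeff : c = 2 * (c / (1 + s)) + (c / (1 + s)) ^ 2 * (v ⬝ᵥ v) := by
    have hne : 1 + s ≠ 0 := by positivity
    field_simp
    linear_combination c * hs
  generalize c / (1 + s) = a at hcoeff ⊢
  rw [hcoeff, sq (1 + _), mul_add, add_mul, add_mul, smul_mul_smul_comm, hsq]
  simp only [one_mul, mul_one]
  module
end

section
/- Let σ > 0, let a ∈ ℝ^m, and for u, w ∈ ℝ^m define k̃(u, w) := ⟨u, w⟩ − ⟨u, a⟩ ⟨a, w⟩ / (σ² + ‖a‖²). Then k̃(a, a) < σ², and for all u, w ∈ ℝ^m: ⟨u, w⟩ = k̃(u, w) + k̃(u, a) · k̃(a, w) / (σ² − k̃(a, a)). -/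
open Matrix

/-- Backward update: with `k̃(u, w) = ⟨u, w⟩ − ⟨u, a⟩⟨a, w⟩/(σ² + ‖a‖²)` (the GP posterior
kernel after observing the point with feature vector `a`), we have `k̃(a, a) < σ²` and
`⟨u, w⟩ = k̃(u, w) + k̃(u, a) k̃(a, w)/(σ² − k̃(a, a))`. -/
theorem stmt_3 (m : ℕ) (σ : ℝ) (hσ : 0 < σ) (a : Fin m → ℝ)
    (ktil : (Fin m → ℝ) → (Fin m → ℝ) → ℝ)
    (hktil : ∀ u w : Fin m → ℝ,
      ktil u w = u ⬝ᵥ w - (u ⬝ᵥ a) * (a ⬝ᵥ w) / (σ ^ 2 + a ⬝ᵥ a)) :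
    ktil a a < σ ^ 2 ∧
      ∀ u w : Fin m → ℝ,
        u ⬝ᵥ w = ktil u w + ktil u a * ktil a w / (σ ^ 2 - ktil a a) := by
  have hs : 0 < σ ^ 2 := by positivity
  have hn : 0 ≤ a ⬝ᵥ a := Finset.sum_nonneg fun i _ => mul_self_nonneg (a i)
  have hsn : 0 < σ ^ 2 + a ⬝ᵥ a := by positivity
  have hgap : σ ^ 2 - ktil a a = (σ ^ 2) ^ 2 / (σ ^ 2 + a ⬝ᵥ a) := by
    rw [hktil]
    field_simp
    ring
  refine ⟨sub_pos.mp (hgap ▸ by positivity), fun u w => ?_⟩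
  have hleft : ktil u a = (u ⬝ᵥ a) * σ ^ 2 / (σ ^ 2 + a ⬝ᵥ a) := by
    rw [hktil]
    field_simp
    ring
  have hright : ktil a w = (a ⬝ᵥ w) * σ ^ 2 / (σ ^ 2 + a ⬝ᵥ a) := by
    rw [hktil]
    field_simp
    ring
  rw [hgap, hleft, hright, hktil]
  field_simp
  ring
end

section
/- Let σ > 0 and let b ∈ ℝ^m with ‖b‖² < σ². Define β̃ := 1 / (√(σ² − ‖b‖²) · (√(σ² − ‖b‖²) + σ)). Then (I + β̃ b bᵀ)² = I + b bᵀ / (σ² − ‖b‖²), and consequently for all u, w ∈ ℝ^m: ⟨(I + β̃ b bᵀ) u, (I + β̃ b bᵀ) w⟩ = ⟨u, w⟩ + ⟨u, b⟩ ⟨b, w⟩ / (σ² − ‖b‖²). -/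
open Matrix

/-- The square of a rank-one perturbation of the identity. -/
lemma one_add_smul_vecMulVec_sq {n R : Type*} [Fintype n] [DecidableEq n] [CommRing R]
    (c : R) (b : n → R) :
    ((1 : Matrix n n R) + c • vecMulVec b b) ^ 2
      = 1 + (2 * c + c ^ 2 * (b ⬝ᵥ b)) • vecMulVec b b := by
  rw [sq, add_mul, mul_add, mul_add, one_mul, mul_one, one_mul, smul_mul_smul_comm,
    vecMulVec_mul_vecMulVec, vecMulVec_smul]
  module

lemma one_add_smul_vecMulVec_mulVec {n R : Type*} [Fintype n] [DecidableEq n] [CommRing R]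
    (c : R) (b u : n → R) :
    ((1 : Matrix n n R) + c • vecMulVec b b) *ᵥ u = u + (c * (b ⬝ᵥ u)) • b := by
  rw [add_mulVec, one_mulVec, smul_mulVec, vecMulVec_mulVec, op_smul_eq_smul, smul_smul]

lemma two_mul_add_sq_mul_eq_inv {σ t β : ℝ} (hσ : 0 < σ) (ht : t < σ ^ 2)
    (hβ : β = 1 / (√(σ ^ 2 - t) * (√(σ ^ 2 - t) + σ))) :
    2 * β + β ^ 2 * t = (σ ^ 2 - t)⁻¹ := by
  have hs : 0 < √(σ ^ 2 - t) := Real.sqrt_pos.mpr (sub_pos.mpr ht)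
  have hsq : √(σ ^ 2 - t) ^ 2 = σ ^ 2 - t := Real.sq_sqrt (sub_pos.mpr ht).le
  generalize √(σ ^ 2 - t) = s at *
  obtain rfl : t = σ ^ 2 - s ^ 2 := by linarith
  rw [sub_sub_cancel, hβ]
  field_simp
  ring

/-- Backward update: square-root formula for the rank-one un-conditioning update.
For `‖b‖² < σ²` and `β̃ = 1 / (√(σ² − ‖b‖²)(√(σ² − ‖b‖²) + σ))`, we have
`(I + β̃ b bᵀ)² = I + b bᵀ / (σ² − ‖b‖²)` and the corresponding inner-product identity.
Here `b ⬝ᵥ b = ‖b‖²`. -/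
theorem stmt_4 (m : ℕ) (σ : ℝ) (hσ : 0 < σ) (b : Fin m → ℝ)
    (hb : b ⬝ᵥ b < σ ^ 2) (β' : ℝ)
    (hβ' : β' = 1 / (Real.sqrt (σ ^ 2 - b ⬝ᵥ b) * (Real.sqrt (σ ^ 2 - b ⬝ᵥ b) + σ))) :
    ((1 : Matrix (Fin m) (Fin m) ℝ) + β' • vecMulVec b b) ^ 2
        = (1 : Matrix (Fin m) (Fin m) ℝ) + (σ ^ 2 - b ⬝ᵥ b)⁻¹ • vecMulVec b b
      ∧ ∀ u w : Fin m → ℝ,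
        (((1 : Matrix (Fin m) (Fin m) ℝ) + β' • vecMulVec b b) *ᵥ u) ⬝ᵥ
            (((1 : Matrix (Fin m) (Fin m) ℝ) + β' • vecMulVec b b) *ᵥ w)
          = u ⬝ᵥ w + (u ⬝ᵥ b) * (b ⬝ᵥ w) / (σ ^ 2 - b ⬝ᵥ b) := by
  have hc := two_mul_add_sq_mul_eq_inv hσ hb hβ'
  refine ⟨by rw [one_add_smul_vecMulVec_sq, hc], fun u w => ?_⟩
  rw [one_add_smul_vecMulVec_mulVec, one_add_smul_vecMulVec_mulVec, div_eq_mul_inv, ← hc]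
  simp only [add_dotProduct, dotProduct_add, smul_dotProduct, dotProduct_smul, smul_eq_mul,
    dotProduct_comm b u]
  ring
end

section
/- Let 𝒳 be a set with pseudometric d, let P ⊆ 𝒳 be a finite nonempty pool set, let M ⊆ 𝒳 be a finite set of already-selected points, and let N ∈ {1, …, |P|}. Let x₁, …, x_N be a sequence of distinct points of P selected greedily with respect to d, and let B := {x₁, …, x_N}. Then Δ_d(B) ≤ 2 Δ_d^N. -/
open scoped ENNReal

/-- `minDistE d x S = inf_{y ∈ S} d(x, y)`, with the infimum over the empty set being `+∞`. -/
noncomputable def minDistE {𝒳 : Type*} (d : 𝒳 → 𝒳 → ℝ) (x : 𝒳) (S : Finset 𝒳) : ℝ≥0∞ :=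
  ⨅ y ∈ S, ENNReal.ofReal (d x y)

/-- `Δ_d(B) = max_{x ∈ P} inf_{y ∈ M ∪ B} d(x, y)`. -/
noncomputable def deltaCover {𝒳 : Type*} [DecidableEq 𝒳] (d : 𝒳 → 𝒳 → ℝ)
    (P M B : Finset 𝒳) : ℝ≥0∞ :=
  ⨆ x ∈ P, minDistE d x (M ∪ B)

/-- `Δ_d^N = min_{B ⊆ P, |B| = N} Δ_d(B)`. -/
noncomputable def deltaOpt {𝒳 : Type*} [DecidableEq 𝒳] (d : 𝒳 → 𝒳 → ℝ)
    (P M : Finset 𝒳) (N : ℕ) : ℝ≥0∞ :=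
  ⨅ B : Finset 𝒳, ⨅ _ : B ⊆ P ∧ B.card = N, deltaCover d P M B

/-- A finite bound on the distance to a finite set is realised by one of its points. -/
theorem exists_mem_ofReal_le_of_minDistE_le {𝒳 : Type*} {d : 𝒳 → 𝒳 → ℝ} {x : 𝒳} {S : Finset 𝒳}
    {r : ℝ≥0∞} (hr : r < ⊤) (h : minDistE d x S ≤ r) : ∃ y ∈ S, ENNReal.ofReal (d x y) ≤ r := by
  by_contra! hS
  rw [minDistE, ← Finset.inf_eq_iInf] at h
  exact absurd ((Finset.lt_inf_iff hr).2 hS) h.not_gt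

theorem minDistE_le {𝒳 : Type*} (d : 𝒳 → 𝒳 → ℝ) (x : 𝒳) {y : 𝒳} {S : Finset 𝒳} (hy : y ∈ S) :
    minDistE d x S ≤ ENNReal.ofReal (d x y) :=
  iInf₂_le y hy

theorem minDistE_anti {𝒳 : Type*} (d : 𝒳 → 𝒳 → ℝ) (x : 𝒳) {S T : Finset 𝒳} (h : S ⊆ T) :
    minDistE d x T ≤ minDistE d x S :=
  le_iInf₂ fun _ hy => minDistE_le d x (h hy)

theorem minDistE_le_deltaCover {𝒳 : Type*} [DecidableEq 𝒳] (d : 𝒳 → 𝒳 → ℝ) {P : Finset 𝒳}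
    (M B : Finset 𝒳) {p : 𝒳} (hp : p ∈ P) : minDistE d p (M ∪ B) ≤ deltaCover d P M B :=
  le_iSup₂ (f := fun x (_ : x ∈ P) => minDistE d x (M ∪ B)) p hp

/-- If more than `B.card` points of `P` have distance greater than `2 * Δ_d(B)` from `M`,
then two of them have distance at most `2 * Δ_d(B)` from each other. -/
theorem exists_ne_ofReal_le_two_mul_deltaCover {𝒳 ι : Type*} [DecidableEq 𝒳] [Fintype ι]
    {d : 𝒳 → 𝒳 → ℝ} (hsymm : ∀ x y, d x y = d y x) (htri : ∀ x y z, d x z ≤ d x y + d y z)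
    {P M B : Finset 𝒳} (hB : deltaCover d P M B < ⊤) (hcard : B.card < Fintype.card ι)
    (q : ι → 𝒳) (hqP : ∀ a, q a ∈ P)
    (hqM : ∀ a, ∀ m ∈ M, 2 * deltaCover d P M B < ENNReal.ofReal (d (q a) m)) :
    ∃ a b, a ≠ b ∧ ENNReal.ofReal (d (q a) (q b)) ≤ 2 * deltaCover d P M B := by
  have hcenter : ∀ a, ∃ c ∈ B, ENNReal.ofReal (d (q a) c) ≤ deltaCover d P M B := by
    intro a
    obtain ⟨c, hc, hac⟩ :=
      exists_mem_ofReal_le_of_minDistE_le hB (minDistE_le_deltaCover d M B (hqP a))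
    rcases Finset.mem_union.1 hc with hcM | hcB
    · refine absurd (hac.trans ?_) (hqM a c hcM).not_ge
      rw [two_mul]
      exact le_self_add
    · exact ⟨c, hcB, hac⟩
  choose c hcB hc using hcenter
  obtain ⟨a, -, b, -, hab, hcab⟩ := Finset.exists_ne_map_eq_of_card_lt_of_maps_to
    (s := Finset.univ) (t := B) (by simpa using hcard) (f := c) (fun a _ => hcB a)
  refine ⟨a, b, hab, ?_⟩
  calc ENNReal.ofReal (d (q a) (q b))
      ≤ ENNReal.ofReal (d (q a) (c a) + d (c a) (q b)) :=
        ENNReal.ofReal_le_ofReal (htri _ _ _)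
    _ ≤ ENNReal.ofReal (d (q a) (c a)) + ENNReal.ofReal (d (c a) (q b)) :=
        ENNReal.ofReal_add_le
    _ ≤ deltaCover d P M B + deltaCover d P M B := by
        gcongr
        · exact hc a
        · rw [hcab, hsymm]
          exact hc b
    _ = 2 * deltaCover d P M B := (two_mul _).symm

/-- The greedy distance maximization (MaxDist) selection yields a batch whose covering
radius is at most twice the optimal covering radius: `Δ_d(B) ≤ 2 Δ_d^N`. -/
theorem stmt_6 {𝒳 : Type*} [DecidableEq 𝒳] (d : 𝒳 → 𝒳 → ℝ)
    (hrefl : ∀ x, d x x = 0) (hsymm : ∀ x y, d x y = d y x)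
    (htri : ∀ x y z, d x z ≤ d x y + d y z)
    (P M : Finset 𝒳) (hP : P.Nonempty) (N : ℕ) (hN₁ : 1 ≤ N) (hN₂ : N ≤ P.card)
    (x : Fin N → 𝒳) (hinj : Function.Injective x) (hxP : ∀ i, x i ∈ P)
    (hgreedy : ∀ i : Fin N, ∀ y ∈ P, (∀ j : Fin N, j < i → x j ≠ y) →
      minDistE d y (M ∪ (Finset.univ.filter (fun j : Fin N => j < i)).image x)
        ≤ minDistE d (x i) (M ∪ (Finset.univ.filter (fun j : Fin N => j < i)).image x)) :
    deltaCover d P M (Finset.univ.image x) ≤ 2 * deltaOpt d P M N := by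
  rw [deltaOpt, ENNReal.mul_iInf_of_ne two_ne_zero ENNReal.ofNat_ne_top]
  refine le_iInf fun B => ?_
  rw [ENNReal.mul_iInf_of_ne two_ne_zero ENNReal.ofNat_ne_top]
  refine le_iInf fun ⟨_, hBN⟩ => ?_
  refine iSup₂_le fun p hp => ?_
  by_contra! hfar
  have hBtop : deltaCover d P M B < ⊤ := by
    refine lt_of_le_of_lt ?_ (hfar.trans_le le_top)
    rw [two_mul]
    exact le_self_add
  have hpx : ∀ j, x j ≠ p := by
    rintro j rfl
    have h := minDistE_le d (x j)
      (Finset.mem_union_right M (Finset.mem_image_of_mem x (Finset.mem_univ j)))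
    rw [hrefl, ENNReal.ofReal_zero] at h
    exact absurd (hfar.trans_le h) not_lt_zero
  have hpfar : ∀ y ∈ M ∪ Finset.univ.image x,
      2 * deltaCover d P M B < ENNReal.ofReal (d p y) :=
    fun y hy => hfar.trans_le (minDistE_le d p hy)
  have hxfar : ∀ i, ∀ y ∈ M ∪ (Finset.univ.filter (fun j : Fin N => j < i)).image x,
      2 * deltaCover d P M B < ENNReal.ofReal (d (x i) y) := fun i y hy =>
    calc 2 * deltaCover d P M B
        < minDistE d p (M ∪ Finset.univ.image x) := hfar
      _ ≤ minDistE d p (M ∪ (Finset.univ.filter (fun j : Fin N => j < i)).image x) :=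
          minDistE_anti d p (Finset.union_subset_union_right
            (Finset.image_subset_image (Finset.filter_subset _ _)))
      _ ≤ minDistE d (x i) (M ∪ (Finset.univ.filter (fun j : Fin N => j < i)).image x) :=
          hgreedy i p hp fun j _ => hpx j
      _ ≤ ENNReal.ofReal (d (x i) y) := minDistE_le d (x i) hy
  have hxx : ∀ i j, j < i → 2 * deltaCover d P M B < ENNReal.ofReal (d (x i) (x j)) :=
    fun i j hji => hxfar i (x j) (Finset.mem_union_right M
      (Finset.mem_image_of_mem x (by simpa using hji)))
  have hpx_far : ∀ j, 2 * deltaCover d P M B < ENNReal.ofReal (d p (x j)) := fun j =>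
    hpfar (x j) (Finset.mem_union_right M (Finset.mem_image_of_mem x (Finset.mem_univ j)))
  obtain ⟨a, b, hab, hle⟩ := exists_ne_ofReal_le_two_mul_deltaCover hsymm htri hBtop
    (ι := Option (Fin N)) (by simp [hBN]) (fun a => a.elim p x)
    (by rintro (_ | i); exacts [hp, hxP i])
    (by
      rintro (_ | i) m hm
      exacts [hpfar m (Finset.mem_union_left _ hm), hxfar i m (Finset.mem_union_left _ hm)])
  refine hle.not_gt ?_
  rcases a with _ | i <;> rcases b with _ | j
  · exact absurd rfl hab
  · exact hpx_far j
  · simpa only [Option.elim, hsymm (x i) p] using hpx_far i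
  · rcases lt_or_gt_of_ne (fun h : i = j => hab (congrArg some h)) with h | h
    · simpa only [Option.elim, hsymm (x i) (x j)] using hxx j i h
    · exact hxx i j h
end
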